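/- arXiv:1606.00978 — 2 statements merged into one kernel-verified Lean document; each statement's English description precedes it below -/
import Mathlib

section
/- (Homogeneous chain with parameter-independent creation operators, XXZ case.) In the setting of the local-structure theorem for the XXZ case, assume additionally that the chain is homogeneous, ξ₁ = ⋯ = ξ_N = ξ, that for each j the operator Bⱼ(λ) = Bⱼ is independent of λ ∈ Λ, and that α(λ_l,ξ) ≠ 0 and δ(λ_l,ξ) ≠ 0 for l = 1, …, M. Then for λ₁, …, λ_M ∈ Λ with sinh(λⱼ−λ_k) ≠ 0 for all j ≠ k: B(λ₁)⋯B(λ_M)|0⟩ = ( ∏_{l=1}^M δ(λ_l,ξ)^N / α(λ_l,ξ) ) Σ_{1≤n₁<⋯<n_M≤N} B_{n₁}B_{n₂}⋯B_{n_M}|0⟩ × Σ_{σ ∈ S_M} ( ∏_{1≤i<j≤M} f(λ_{σ(i)},λ_{σ(j)}) ) ∏_{k=1}^M ( α(λ_{σ(k)},ξ)/δ(λ_{σ(k)},ξ) )^{n_k}, where f(λ,μ) = sinh(λ−μ+η)/sinh(λ−μ), S_M is the symmetric group on {1,…,M}, and B(λ) is the (1,2) entry of T(λ) = L₁(λ)⋯L_N(λ).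 -/
open scoped BigOperators

noncomputable section

/-- The endomorphism algebra of a complex vector space `H`. -/
abbrev EndH (H : Type) [AddCommGroup H] [Module ℂ H] := Module.End ℂ H

/-- The 4×4 matrix `[[f,0,0,0],[0,1,g,0],[0,g,1,0],[0,0,0,f]]` acting on `ℂ² ⊗ ℂ²`,
indexed by `Fin 2 × Fin 2` (standard tensor basis). -/
def Rfg (f g : ℂ) : Matrix (Fin 2 × Fin 2) (Fin 2 × Fin 2) ℂ :=
  fun p q =>
    if p = q then (if p.1 = p.2 then f else 1)
    else if p.1 = q.2 ∧ p.2 = q.1 then g else 0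

/-- Rational function `f(λ,μ) = (λ-μ+1)/(λ-μ)`. -/
def fXXX (l m : ℂ) : ℂ := (l - m + 1) / (l - m)

/-- Rational function `g(λ,μ) = 1/(λ-μ)`. -/
def gXXX (l m : ℂ) : ℂ := 1 / (l - m)

/-- The rational (XXX-type) R-matrix. -/
def RXXX (l m : ℂ) : Matrix (Fin 2 × Fin 2) (Fin 2 × Fin 2) ℂ := Rfg (fXXX l m) (gXXX l m)

/-- Trigonometric `f(λ,μ) = sinh(λ-μ+η)/sinh(λ-μ)`. -/
def fXXZ (η l m : ℂ) : ℂ := Complex.sinh (l - m + η) / Complex.sinh (l - m)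

/-- Trigonometric `g(λ,μ) = sinh η / sinh(λ-μ)`. -/
def gXXZ (η l m : ℂ) : ℂ := Complex.sinh η / Complex.sinh (l - m)

/-- The trigonometric (XXZ-type) R-matrix with anisotropy `η`. -/
def RXXZ (η l m : ℂ) : Matrix (Fin 2 × Fin 2) (Fin 2 × Fin 2) ℂ :=
  Rfg (fXXZ η l m) (gXXZ η l m)

variable {H : Type} [AddCommGroup H] [Module ℂ H]

/-- `T₁(λ)`: the 2×2 operator matrix `T` acting in the first auxiliary space `ℂ²`
(and in `H`), identity in the second auxiliary space. -/
def aux1 (T : Matrix (Fin 2) (Fin 2) (EndH H)) :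
    Matrix (Fin 2 × Fin 2) (Fin 2 × Fin 2) (EndH H) :=
  fun p q => if p.2 = q.2 then T p.1 q.1 else 0

/-- `T₂(μ)`: the 2×2 operator matrix `T` acting in the second auxiliary space `ℂ²`
(and in `H`), identity in the first auxiliary space. -/
def aux2 (T : Matrix (Fin 2) (Fin 2) (EndH H)) :
    Matrix (Fin 2 × Fin 2) (Fin 2 × Fin 2) (EndH H) :=
  fun p q => if p.1 = q.1 then T p.2 q.2 else 0

/-- A scalar 4×4 matrix viewed as a matrix of endomorphisms of `H`
(i.e. `R ⊗ id_H` on `ℂ² ⊗ ℂ² ⊗ H`). -/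
def embedR (R : Matrix (Fin 2 × Fin 2) (Fin 2 × Fin 2) ℂ) :
    Matrix (Fin 2 × Fin 2) (Fin 2 × Fin 2) (EndH H) :=
  R.map (fun c => c • (1 : EndH H))

/-- The RTT relation `R₁₂(λ,μ) T₁(λ) T₂(μ) = T₂(μ) T₁(λ) R₁₂(λ,μ)` in
`End(ℂ² ⊗ ℂ² ⊗ H)`, for all `λ, μ ∈ Λ` which are admissible (`adm λ μ`). -/
def SatisfiesRTT (Λ : Set ℂ) (adm : ℂ → ℂ → Prop)
    (R : ℂ → ℂ → Matrix (Fin 2 × Fin 2) (Fin 2 × Fin 2) ℂ)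
    (T : ℂ → Matrix (Fin 2) (Fin 2) (EndH H)) : Prop :=
  ∀ lam mu : ℂ, lam ∈ Λ → mu ∈ Λ → adm lam mu →
    embedR (R lam mu) * aux1 (T lam) * aux2 (T mu)
      = aux2 (T mu) * aux1 (T lam) * embedR (R lam mu)

/-- Ordered product `∏_{k ∈ s} B k` of endomorphisms indexed by a finset of a linearly
ordered type, taken in increasing order of the index. -/
def finsetOpProd {ι : Type} [LinearOrder ι] (s : Finset ι) (B : ι → EndH H) : EndH H :=
  ((s.sort (· ≤ ·)).map B).prod

/-! ### The quadratic relations of a two-by-two monodromy matrix -/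

section Relations

variable {X Y : Matrix (Fin 2) (Fin 2) (EndH H)} {f g : ℂ}

/-- The exchange relation of the diagonal entry `A` with `B`. -/
lemma rtt_exchange_A (h : embedR (Rfg f g) * aux1 X * aux2 Y = aux2 Y * aux1 X * embedR (Rfg f g)) :
    Y 0 0 * X 0 1 = f • (X 0 1 * Y 0 0) - g • (Y 0 1 * X 0 0) := by
  have h1 := congrFun (congrFun h (0, 0)) (1, 0)
  simp [Matrix.mul_apply, Fintype.sum_prod_type, aux1, aux2, embedR, Rfg] at h1
  rw [h1]
  abel

/-- The exchange relation of the diagonal entry `D` with `B`. -/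
lemma rtt_exchange_D (h : embedR (Rfg f g) * aux1 X * aux2 Y = aux2 Y * aux1 X * embedR (Rfg f g)) :
    X 1 1 * Y 0 1 = f • (Y 0 1 * X 1 1) - g • (X 0 1 * Y 1 1) := by
  have h1 := congrFun (congrFun h (1, 0)) (1, 1)
  simp [Matrix.mul_apply, Fintype.sum_prod_type, aux1, aux2, embedR, Rfg] at h1
  rw [← h1]
  abel

lemma aux1_mul (X Y : Matrix (Fin 2) (Fin 2) (EndH H)) : aux1 (X * Y) = aux1 X * aux1 Y := by
  ext1 p q
  obtain ⟨p1, p2⟩ := p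
  obtain ⟨q1, q2⟩ := q
  fin_cases p2 <;> fin_cases q2 <;>
    simp [Matrix.mul_apply, Fintype.sum_prod_type, aux1]

lemma aux2_mul (X Y : Matrix (Fin 2) (Fin 2) (EndH H)) : aux2 (X * Y) = aux2 X * aux2 Y := by
  ext1 p q
  obtain ⟨p1, p2⟩ := p
  obtain ⟨q1, q2⟩ := q
  fin_cases p1 <;> fin_cases q1 <;>
    simp [Matrix.mul_apply, Fintype.sum_prod_type, aux2]

lemma aux1_mul_aux2_comm (h : ∀ a b c d, Commute (X a b) (Y c d)) :
    aux1 X * aux2 Y = aux2 Y * aux1 X := by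
  ext1 p q
  obtain ⟨p1, p2⟩ := p
  obtain ⟨q1, q2⟩ := q
  fin_cases p1 <;> fin_cases p2 <;> fin_cases q1 <;> fin_cases q2 <;>
    simp [Matrix.mul_apply, Fintype.sum_prod_type, aux1, aux2, (h _ _ _ _).eq]

/-- The RTT relation is inherited by the product of two commuting monodromy matrices. -/
lemma rtt_mul {R : Matrix (Fin 2 × Fin 2) (Fin 2 × Fin 2) (EndH H)}
    {X' Y' : Matrix (Fin 2) (Fin 2) (EndH H)}
    (h : R * aux1 X * aux2 Y = aux2 Y * aux1 X * R)
    (h' : R * aux1 X' * aux2 Y' = aux2 Y' * aux1 X' * R)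
    (hc : ∀ a b c d, Commute (X' a b) (Y c d)) (hc' : ∀ a b c d, Commute (X a b) (Y' c d)) :
    R * aux1 (X * X') * aux2 (Y * Y') = aux2 (Y * Y') * aux1 (X * X') * R := by
  rw [aux1_mul, aux2_mul]
  calc R * (aux1 X * aux1 X') * (aux2 Y * aux2 Y')
      = R * aux1 X * (aux1 X' * aux2 Y) * aux2 Y' := by noncomm_ring
    _ = (R * aux1 X * aux2 Y) * aux1 X' * aux2 Y' := by
        rw [aux1_mul_aux2_comm hc]; noncomm_ring
    _ = aux2 Y * aux1 X * (R * aux1 X' * aux2 Y') := by rw [h]; noncomm_ring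
    _ = aux2 Y * (aux1 X * aux2 Y') * aux1 X' * R := by rw [h']; noncomm_ring
    _ = aux2 Y * aux2 Y' * (aux1 X * aux1 X') * R := by
        rw [aux1_mul_aux2_comm hc']; noncomm_ring

end Relations

/-! ### Bethe vectors indexed by finite sets of spectral parameters -/

section BetheVectors

variable {ι : Type} [DecidableEq ι]

/-- The Bethe vector of a homogeneous chain with creation operators `B`, given recursively by
splitting off the first site of the chain. -/
def betheVec (f : ι → ι → ℂ) (α δ : ι → ℂ) (v0 : H) :
    (N : ℕ) → (Fin N → EndH H) → Finset ι → H
  | 0, _, S => if S = ∅ then v0 else 0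
  | N + 1, B, S =>
      (∏ j ∈ S, α j) • betheVec f α δ v0 N (fun i => B i.succ) S +
        ∑ k ∈ S, (δ k ^ N * ∏ j ∈ S.erase k, f k j * α j) •
          B 0 (betheVec f α δ v0 N (fun i => B i.succ) (S.erase k))

lemma betheVec_empty (f : ι → ι → ℂ) (α δ : ι → ℂ) (v0 : H) (N : ℕ) (B : Fin N → EndH H) :
    betheVec f α δ v0 N B ∅ = v0 := by
  induction N with
  | zero => simp [betheVec]
  | succ N ih => simp [betheVec, ih]

/-- An operator commuting with all creation operators acts on a Bethe vector as on the vacuum. -/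
lemma apply_of_commute_creation {B : ι → EndH H} {Ψ : Finset ι → H}
    (hΨ : ∀ i S, i ∉ S → B i (Ψ S) = Ψ (insert i S))
    {E : EndH H} (hE : ∀ i, Commute E (B i)) {c : ℂ} (h0 : E (Ψ ∅) = c • Ψ ∅) (S : Finset ι) :
    E (Ψ S) = c • Ψ S := by
  induction S using Finset.induction_on with
  | empty => exact h0
  | insert i S hi ih =>
    rw [← hΨ i S hi, ← Module.End.mul_apply, (hE i).eq, Module.End.mul_apply, ih, map_smul]

/-- The action of `D` on a Bethe vector. -/
lemma D_apply_betheVec {f g : ι → ι → ℂ}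
    (hfg : ∀ m i k, m ≠ i → m ≠ k → i ≠ k → f m i * g m k - g m i * g i k = g m k * f k i)
    {B D : ι → EndH H} {Ψ : Finset ι → H}
    (hΨ : ∀ i S, i ∉ S → B i (Ψ S) = Ψ (insert i S))
    (hDB : ∀ i j, i ≠ j → D i * B j = f i j • (B j * D i) - g i j • (B i * D j))
    {d : ι → ℂ} (hD : ∀ i, D i (Ψ ∅) = d i • Ψ ∅) (S : Finset ι) :
    ∀ m ∉ S, D m (Ψ S) = ((∏ j ∈ S, f m j) * d m) • Ψ S -
      ∑ k ∈ S, (g m k * (∏ j ∈ S.erase k, f k j) * d k) • Ψ (insert m (S.erase k)) := by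
  induction S using Finset.induction_on with
  | empty => intro m _; simp [hD]
  | insert i S hi ih =>
    intro m hm
    rw [Finset.mem_insert, not_or] at hm
    obtain ⟨hmi, hmS⟩ := hm
    have hswap : ∀ T : Finset ι, m ∉ T → B m (Ψ (insert i T)) = Ψ (insert m (insert i T)) :=
      fun T h2 => hΨ m _ (by simp [hmi, h2])
    have hswap' : ∀ T : Finset ι, i ∉ T → B i (Ψ (insert m T)) = Ψ (insert m (insert i T)) :=
      fun T h1 => by
        rw [hΨ i _ (by simp [Ne.symm hmi, h1]), Finset.insert_comm]
    rw [← hΨ i S hi, ← Module.End.mul_apply, hDB m i hmi]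
    simp only [LinearMap.sub_apply, LinearMap.smul_apply, Module.End.mul_apply]
    rw [ih m hmS, ih i hi, Finset.sum_insert hi, Finset.prod_insert hi, Finset.erase_insert hi]
    simp only [map_sub, map_smul, map_sum, smul_sub, smul_smul, Finset.smul_sum]
    rw [hΨ i S hi, hΨ m S hmS]
    have key : ∀ k ∈ S,
        (g m k * (∏ j ∈ (insert i S).erase k, f k j) * d k) • Ψ (insert m ((insert i S).erase k)) =
        (f m i * (g m k * (∏ j ∈ S.erase k, f k j) * d k)) • B i (Ψ (insert m (S.erase k))) -
        (g m i * (g i k * (∏ j ∈ S.erase k, f k j) * d k)) • B m (Ψ (insert i (S.erase k))) := by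
      intro k hk
      have hik : i ≠ k := fun h => hi (h ▸ hk)
      have hmk : m ≠ k := fun h => hmS (h ▸ hk)
      have h1 : i ∉ S.erase k := fun h => hi (Finset.mem_of_mem_erase h)
      have h2 : m ∉ S.erase k := fun h => hmS (Finset.mem_of_mem_erase h)
      rw [hswap _ h2, hswap' _ h1, Finset.erase_insert_of_ne hik, Finset.prod_insert h1,
        ← sub_smul]
      congr 1
      linear_combination (-(∏ j ∈ S.erase k, f k j) * d k) * hfg m i k hmi hmk hik
    rw [Finset.sum_congr rfl key, Finset.sum_sub_distrib]
    simp only [mul_assoc]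
    abel

lemma commute_list_prod_matrix {X : Matrix (Fin 2) (Fin 2) (EndH H)}
    (l : List (Matrix (Fin 2) (Fin 2) (EndH H)))
    (h : ∀ Y ∈ l, ∀ a b c d, Commute (X a b) (Y c d)) (a b c d : Fin 2) :
    Commute (X a b) (l.prod c d) := by
  induction l generalizing c d with
  | nil =>
    rw [List.prod_nil, Matrix.one_apply]
    split_ifs
    · exact Commute.one_right _
    · exact Commute.zero_right _
  | cons Y l ih =>
    rw [List.prod_cons, Matrix.mul_apply]
    refine Commute.sum_right _ _ _ fun e _ => Commute.mul_right (h Y (by simp) _ _ _ _) ?_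
    exact ih (fun Z hZ => h Z (by simp [hZ])) _ _

/-- The total monodromy matrix of the chain satisfies the RTT relation. -/
lemma rtt_ofFn_prod {R : Matrix (Fin 2 × Fin 2) (Fin 2 × Fin 2) ℂ} {N : ℕ}
    {X Y : Fin N → Matrix (Fin 2) (Fin 2) (EndH H)}
    (h : ∀ n, embedR R * aux1 (X n) * aux2 (Y n) = aux2 (Y n) * aux1 (X n) * embedR R)
    (hXY : ∀ m n, m ≠ n → ∀ a b c d, Commute (X m a b) (Y n c d)) :
    embedR R * aux1 (List.ofFn X).prod * aux2 (List.ofFn Y).prod =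
      aux2 (List.ofFn Y).prod * aux1 (List.ofFn X).prod * embedR R := by
  induction N with
  | zero =>
    have h1 : aux1 (1 : Matrix (Fin 2) (Fin 2) (EndH H)) = 1 := by
      ext1 p q
      obtain ⟨p1, p2⟩ := p
      obtain ⟨q1, q2⟩ := q
      simp only [aux1, Matrix.one_apply, Prod.mk.injEq]
      split_ifs <;> simp_all
    have h2 : aux2 (1 : Matrix (Fin 2) (Fin 2) (EndH H)) = 1 := by
      ext1 p q
      obtain ⟨p1, p2⟩ := p
      obtain ⟨q1, q2⟩ := q
      simp only [aux2, Matrix.one_apply, Prod.mk.injEq]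
      split_ifs <;> simp_all
    simp [h1, h2]
  | succ N ih =>
    rw [List.ofFn_succ, List.ofFn_succ, List.prod_cons, List.prod_cons]
    refine rtt_mul (h 0) (ih (fun n => h n.succ)
      fun m n hmn => hXY _ _ fun hh => hmn (Fin.succ_injective _ hh)) ?_ ?_
    · intro a b c d
      refine (commute_list_prod_matrix _ ?_ c d a b).symm
      intro Z hZ a b c d
      obtain ⟨n, rfl⟩ := (List.mem_ofFn' _ _).1 hZ
      exact (hXY _ _ (Fin.succ_ne_zero n) c d a b).symm
    · refine commute_list_prod_matrix _ ?_
      intro Z hZ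
      obtain ⟨n, rfl⟩ := (List.mem_ofFn' _ _).1 hZ
      exact hXY _ _ (Fin.succ_ne_zero n).symm

/-- The `D` operator of the total monodromy matrix acts diagonally on the vacuum. -/
lemma ofFn_prod_apply_vacuum {N : ℕ} {X : Fin N → Matrix (Fin 2) (Fin 2) (EndH H)} {v0 : H} {δ : ℂ}
    (hcomm : ∀ m n, m ≠ n → ∀ a b c d, Commute (X m a b) (X n c d))
    (hD : ∀ n, X n 1 1 v0 = δ • v0) (hC : ∀ n, X n 1 0 v0 = 0) :
    (List.ofFn X).prod 1 1 v0 = δ ^ N • v0 := by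
  induction N with
  | zero => simp
  | succ N ih =>
    have h1 := ih (fun m n hmn => hcomm m.succ n.succ fun hh => hmn (Fin.succ_injective _ hh))
      (fun n => hD n.succ) (fun n => hC n.succ)
    have h2 : Commute (X 0 1 0) ((List.ofFn fun n : Fin N => X n.succ).prod 0 1) := by
      refine commute_list_prod_matrix _ ?_ _ _ _ _
      intro Z hZ
      obtain ⟨n, rfl⟩ := (List.mem_ofFn' _ _).1 hZ
      exact hcomm _ _ (Fin.succ_ne_zero n).symm
    rw [List.ofFn_succ, List.prod_cons, Matrix.mul_apply, Fin.sum_univ_two, h2.eq]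
    simp [hC, h1, hD, smul_smul, pow_succ]

/-- The creation operators of a homogeneous chain with parameter-independent local creation
operators build up the Bethe vectors one spectral parameter at a time. -/
lemma creation_apply_betheVec {f g : ι → ι → ℂ} (hg : ∀ i j, g i j = -g j i)
    (hfg : ∀ m i k, m ≠ i → m ≠ k → i ≠ k → f m i * g m k - g m i * g i k = g m k * f k i)
    {α δ : ι → ℂ} {v0 : H} {N : ℕ} {L : Fin N → ι → Matrix (Fin 2) (Fin 2) (EndH H)}
    {B : Fin N → EndH H}
    (hRTT : ∀ n i j, i ≠ j → embedR (Rfg (f i j) (g i j)) * aux1 (L n i) * aux2 (L n j) =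
      aux2 (L n j) * aux1 (L n i) * embedR (Rfg (f i j) (g i j)))
    (hcomm : ∀ m n, m ≠ n → ∀ i j a b c d, Commute (L m i a b) (L n j c d))
    (hA : ∀ n i, L n i 0 0 v0 = α i • v0) (hD : ∀ n i, L n i 1 1 v0 = δ i • v0)
    (hC : ∀ n i, L n i 1 0 v0 = 0) (hB : ∀ n i, L n i 0 1 = B n) (hBB : ∀ n, B n (B n v0) = 0)
    (i : ι) (S : Finset ι) (hi : i ∉ S) :
    (List.ofFn fun n => L n i).prod 0 1 (betheVec f α δ v0 N B S) =
      betheVec f α δ v0 N B (insert i S) := by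
  induction N generalizing i S with
  | zero => simp [betheVec]
  | succ N ih =>
    have hne : ∀ {m n : Fin N}, m ≠ n → m.succ ≠ n.succ :=
      fun hmn hh => hmn (Fin.succ_injective _ hh)
    set Ψ : Finset ι → H := betheVec f α δ v0 N (fun n => B n.succ) with hΨdef
    set T : ι → Matrix (Fin 2) (Fin 2) (EndH H) :=
      fun i => (List.ofFn fun n : Fin N => L n.succ i).prod with hTdef
    have hΨ : ∀ i S, i ∉ S → T i 0 1 (Ψ S) = Ψ (insert i S) := fun i S hi =>
      ih (L := fun n => L n.succ) (B := fun n => B n.succ) (fun n => hRTT n.succ)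
        (fun m n hmn => hcomm _ _ (hne hmn)) (fun n => hA n.succ) (fun n => hD n.succ)
        (fun n => hC n.succ) (fun n => hB n.succ) (fun n => hBB n.succ) i S hi
    have hΨ0 : Ψ ∅ = v0 := betheVec_empty _ _ _ _ _ _
    have hLT : ∀ i j a b c d, Commute (L 0 i a b) (T j c d) := by
      intro i j
      refine commute_list_prod_matrix _ ?_
      intro Z hZ
      obtain ⟨n, rfl⟩ := (List.mem_ofFn' _ _).1 hZ
      exact hcomm _ _ (Fin.succ_ne_zero n).symm i j
    have hB0T : ∀ j c d, Commute (B 0) (T j c d) := fun j c d => hB 0 i ▸ hLT i j 0 1 c d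
    have hTD : ∀ i, T i 1 1 (Ψ ∅) = δ i ^ N • Ψ ∅ := fun i => by
      rw [hΨ0]
      exact ofFn_prod_apply_vacuum (fun m n hmn => hcomm _ _ (hne hmn) i i)
        (fun n => hD n.succ i) (fun n => hC n.succ i)
    have hDB : ∀ i j, i ≠ j → T i 1 1 * T j 0 1 =
        f i j • (T j 0 1 * T i 1 1) - g i j • (T i 0 1 * T j 1 1) := fun i j hij =>
      rtt_exchange_D (rtt_ofFn_prod (fun n => hRTT n.succ i j hij)
        fun m n hmn => hcomm _ _ (hne hmn) i j)
    have hAΨ : ∀ S, L 0 i 0 0 (Ψ S) = α i • Ψ S :=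
      apply_of_commute_creation hΨ (fun j => hLT i j 0 0 0 1) (by rw [hΨ0, hA])
    have hBBΨ : ∀ S, B 0 (B 0 (Ψ S)) = 0 := fun S => by
      have := apply_of_commute_creation (E := B 0 * B 0) (c := 0) hΨ
        (fun j => (hB0T j 0 1).mul_left (hB0T j 0 1)) (by simp [hΨ0, hBB]) S
      simpa using this
    have hABΨ : ∀ k, k ≠ i → ∀ S, L 0 i 0 0 (B 0 (Ψ S)) =
        (f k i * α i - g k i * α k) • B 0 (Ψ S) := by
      intro k hk S
      have h1 := rtt_exchange_A (hRTT 0 k i hk)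
      rw [hB, hB] at h1
      have h2 := apply_of_commute_creation
        (E := L 0 i 0 0 * B 0 - (f k i * α i - g k i * α k) • B 0) (c := 0) hΨ
        (fun j => ((hLT i j 0 0 0 1).mul_left (hB0T j 0 1)).sub_left
          ((hB0T j 0 1).smul_left _)) (by
          rw [hΨ0, h1]
          simp [hA, smul_smul, sub_smul]) S
      simpa [sub_eq_zero] using h2
    have hTB : ∀ S, T i 0 1 (B 0 (Ψ S)) = B 0 (T i 0 1 (Ψ S)) := fun S => by
      rw [← Module.End.mul_apply, ← (hB0T i 0 1).eq, Module.End.mul_apply]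
    have hBTDB : ∀ S, B 0 (T i 1 1 (B 0 (Ψ S))) = 0 := fun S => by
      have h1 : B 0 * (T i 1 1 * B 0) = T i 1 1 * (B 0 * B 0) := by
        rw [← mul_assoc, (hB0T i 1 1).eq, mul_assoc]
      have h2 := congrArg (fun E : EndH H => E (Ψ S)) h1
      simpa [hBBΨ] using h2
    have hDΨ := D_apply_betheVec hfg (B := fun i => T i 0 1) (D := fun i => T i 1 1) hΨ hDB hTD
      S i hi
    have hT : (List.ofFn fun n => L n i).prod 0 1 = L 0 i 0 0 * T i 0 1 + B 0 * T i 1 1 := by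
      rw [List.ofFn_succ, List.prod_cons, Matrix.mul_apply, Fin.sum_univ_two, hB]
    have hrec : ∀ S, betheVec f α δ v0 (N + 1) B S = (∏ j ∈ S, α j) • Ψ S +
        ∑ k ∈ S, (δ k ^ N * ∏ j ∈ S.erase k, f k j * α j) • B 0 (Ψ (S.erase k)) := fun _ => rfl
    rw [hT, hrec, hrec]
    simp only [LinearMap.add_apply, Module.End.mul_apply, map_add, map_smul, map_sum, hTB, hBTDB,
      add_zero]
    rw [hΨ i S hi, hAΨ, hDΨ, Finset.sum_insert hi, Finset.prod_insert hi, Finset.erase_insert hi]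
    simp only [map_sub, map_smul, map_sum, smul_add, smul_sub, Finset.smul_sum, smul_smul]
    have key : ∀ k ∈ S,
        (δ k ^ N * ∏ j ∈ (insert i S).erase k, f k j * α j) • B 0 (Ψ ((insert i S).erase k)) =
        (δ k ^ N * ∏ j ∈ S.erase k, f k j * α j) •
          (L 0 i 0 0) (B 0 (T i 0 1 (Ψ (S.erase k)))) -
        ((∏ j ∈ S, α j) * (g i k * (∏ j ∈ S.erase k, f k j) * δ k ^ N)) •
          B 0 (Ψ (insert i (S.erase k))) := by
      intro k hk
      have hik : i ≠ k := fun h => hi (h ▸ hk)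
      have h1 : i ∉ S.erase k := fun h => hi (Finset.mem_of_mem_erase h)
      rw [hΨ i _ h1, hABΨ k hik.symm, Finset.erase_insert_of_ne hik, Finset.prod_insert h1,
        smul_smul, ← sub_smul, ← Finset.mul_prod_erase S α hk, Finset.prod_mul_distrib, hg k i]
      congr 1
      ring
    rw [Finset.sum_congr rfl key, Finset.sum_sub_distrib, Finset.prod_mul_distrib]
    rw [show (∏ j ∈ S, α j) * α i = α i * ∏ j ∈ S, α j from mul_comm _ _,
      show (∏ j ∈ S, α j) * ((∏ j ∈ S, f i j) * δ i ^ N) =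
        δ i ^ N * ((∏ j ∈ S, f i j) * ∏ j ∈ S, α j) by ring]
    abel

end BetheVectors

/-! ### The explicit form of the Bethe vectors -/

section Explicit

/-- Splitting a sum over strictly increasing maps according to whether `0` is a value. -/
lemma sum_strictMono_succ {E : Type*} [AddCommMonoid E] (M N : ℕ)
    (F : (Fin (M + 1) → Fin (N + 1)) → E) :
    ∑ n ∈ Finset.univ.filter (fun n : Fin (M + 1) → Fin (N + 1) => ∀ k l, k < l → n k < n l), F n =
      ∑ n ∈ Finset.univ.filter (fun n : Fin (M + 1) → Fin N => ∀ k l, k < l → n k < n l),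
          F (fun k => (n k).succ) +
        ∑ n ∈ Finset.univ.filter (fun n : Fin M → Fin N => ∀ k l, k < l → n k < n l),
          F (Fin.cons 0 fun k => (n k).succ) := by
  classical
  rw [← Finset.sum_filter_add_sum_filter_not _ (fun n => n 0 ≠ 0)]
  congr 1
  · symm
    refine Finset.sum_bij (fun n _ => fun k => (n k).succ) ?_ ?_ ?_ ?_
    · intro n hn
      simpa using hn
    · intro n _ n' _ h
      funext k
      exact Fin.succ_injective _ (congrFun h k)
    · intro n hn
      simp only [Finset.mem_filter, Finset.mem_univ, true_and] at hn
      have h0 : ∀ k, n k ≠ 0 := by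
        intro k
        rcases Fin.eq_zero_or_eq_succ k with rfl | ⟨k, rfl⟩
        · exact hn.2
        · exact ((Fin.zero_le _).trans_lt (hn.1 0 k.succ (Fin.succ_pos k))).ne'
      refine ⟨fun k => (n k).pred (h0 k), ?_, by simp⟩
      simpa using hn.1
    · intro n _
      rfl
  · symm
    refine Finset.sum_bij (fun n _ => Fin.cons 0 fun k => (n k).succ) ?_ ?_ ?_ ?_
    · intro n hn
      simp only [Finset.mem_filter, Finset.mem_univ, true_and] at hn ⊢
      refine ⟨fun k l => ?_, by simp⟩
      refine Fin.cases ?_ (fun k => ?_) k <;> refine Fin.cases ?_ (fun l => ?_) l <;>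
        simp
      exact hn k l
    · intro n _ n' _ h
      funext k
      simpa using congrFun h k.succ
    · intro n hn
      simp only [Finset.mem_filter, Finset.mem_univ, true_and, not_not] at hn
      have h0 : ∀ k : Fin M, n k.succ ≠ 0 := fun k =>
        ((Fin.zero_le _).trans_lt (hn.1 0 k.succ (Fin.succ_pos k))).ne'
      refine ⟨fun k => (n k.succ).pred (h0 k), ?_, ?_⟩
      · simp only [Finset.mem_filter, Finset.mem_univ, true_and, Fin.pred_lt_pred_iff]
        exact fun k l hkl => hn.1 _ _ (Fin.succ_lt_succ_iff.2 hkl)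
      · funext k
        refine Fin.cases ?_ (fun k => ?_) k
        · simp [hn.2]
        · simp
    · intro n _
      rfl

lemma prod_prod_lt_succ {M : ℕ} (F : Fin (M + 1) → Fin (M + 1) → ℂ) :
    ∏ i, ∏ j ∈ Finset.univ.filter (fun j => i < j), F i j =
      (∏ j : Fin M, F 0 j.succ) *
        ∏ i : Fin M, ∏ j ∈ Finset.univ.filter (fun j => i < j), F i.succ j.succ := by
  simp only [Finset.prod_filter, Fin.prod_univ_succ]
  simp

variable {ι : Type}

/-- The coefficient of `B_{n₁} ⋯ B_{n_M}` in a Bethe vector. -/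
def betheCoeff (f : ι → ι → ℂ) (α δ : ι → ℂ) (N : ℕ) {M : ℕ} (e : Fin M → ι) (n : Fin M → ℕ) : ℂ :=
  (∏ l, δ (e l) ^ N / α (e l)) *
    ∑ σ : Equiv.Perm (Fin M),
      (∏ i, ∏ j ∈ Finset.univ.filter (fun j => i < j), f (e (σ i)) (e (σ j))) *
        ∏ k, (α (e (σ k)) / δ (e (σ k))) ^ (n k + 1)

variable {f : ι → ι → ℂ} {α δ : ι → ℂ}

lemma betheCoeff_shift (hδ : ∀ i, δ i ≠ 0) (N : ℕ) {M : ℕ} (e : Fin M → ι) (n : Fin M → ℕ) :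
    betheCoeff f α δ (N + 1) e (fun k => n k + 1) = (∏ l, α (e l)) * betheCoeff f α δ N e n := by
  have h1 : ∀ σ : Equiv.Perm (Fin M),
      ∏ k, (α (e (σ k)) / δ (e (σ k))) ^ (n k + 1 + 1) =
        (∏ k, (α (e (σ k)) / δ (e (σ k))) ^ (n k + 1)) * ∏ k, (α (e k) / δ (e k)) := by
    intro σ
    rw [← Equiv.prod_comp σ (fun k => α (e k) / δ (e k)), ← Finset.prod_mul_distrib]
    exact Finset.prod_congr rfl fun k _ => pow_succ _ _
  have h2 : (∏ l, δ (e l) ^ (N + 1) / α (e l)) * ∏ k, (α (e k) / δ (e k)) =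
      (∏ l, α (e l)) * ∏ l, δ (e l) ^ N / α (e l) := by
    rw [← Finset.prod_mul_distrib, ← Finset.prod_mul_distrib]
    refine Finset.prod_congr rfl fun k _ => ?_
    rw [pow_succ]
    have := hδ (e k)
    field_simp
  simp only [betheCoeff, h1, ← mul_assoc, ← Finset.sum_mul]
  rw [mul_right_comm, h2]

lemma betheCoeff_cons (hα : ∀ i, α i ≠ 0) (hδ : ∀ i, δ i ≠ 0) (N : ℕ) {M : ℕ}
    (e : Fin (M + 1) → ι) (n : Fin M → ℕ) :
    betheCoeff f α δ (N + 1) e (Fin.cons 0 fun k => n k + 1) =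
      ∑ p, (δ (e p) ^ N * ∏ j : Fin M, f (e p) (e (Equiv.swap 0 p j.succ)) *
          α (e (Equiv.swap 0 p j.succ))) *
        betheCoeff f α δ N (fun k => e (Equiv.swap 0 p k.succ)) n := by
  have hpre : ∀ p : Fin (M + 1), ∏ l, δ (e l) ^ (N + 1) / α (e l) =
      δ (e p) ^ (N + 1) / α (e p) *
        ∏ k : Fin M, δ (e (Equiv.swap 0 p k.succ)) ^ (N + 1) / α (e (Equiv.swap 0 p k.succ)) := by
    intro p
    rw [← Equiv.prod_comp (Equiv.swap 0 p), Fin.prod_univ_succ, Equiv.swap_apply_left]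
  rw [betheCoeff, ← Equiv.sum_comp Equiv.Perm.decomposeFin.symm, Fintype.sum_prod_type,
    Finset.mul_sum]
  refine Finset.sum_congr rfl fun p _ => ?_
  rw [hpre p]
  have hs := betheCoeff_shift (f := f) (α := α) hδ N (fun k => e (Equiv.swap 0 p k.succ)) n
  have hperm : ∀ τ : Equiv.Perm (Fin M),
      ∏ j, f (e p) (e (Equiv.swap 0 p (τ j).succ)) =
        ∏ j : Fin M, f (e p) (e (Equiv.swap 0 p j.succ)) :=
    fun τ => Equiv.prod_comp τ (fun j : Fin M => f (e p) (e (Equiv.swap 0 p j.succ)))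
  simp_rw [prod_prod_lt_succ]
  simp only [Fin.prod_univ_succ, Equiv.Perm.decomposeFin_symm_apply_zero,
    Equiv.Perm.decomposeFin_symm_apply_succ, Fin.cons_zero, Fin.cons_succ, hperm]
  rw [Finset.prod_mul_distrib, ← mul_assoc (δ (e p) ^ N), mul_assoc (δ (e p) ^ N * _), ← hs,
    betheCoeff, Finset.mul_sum, Finset.mul_sum, Finset.mul_sum]
  refine Finset.sum_congr rfl fun τ _ => ?_
  have h1 := hα (e p)
  have h2 := hδ (e p)
  rw [show δ (e p) ^ (N + 1) / α (e p) = δ (e p) ^ N / (α (e p) / δ (e p)) by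
    rw [pow_succ]
    field_simp]
  have h3 : α (e p) / δ (e p) ≠ 0 := div_ne_zero h1 h2
  generalize α (e p) / δ (e p) = r at *
  simp only [zero_add, pow_one]
  field_simp

variable [DecidableEq ι]

lemma image_swap_succ {M : ℕ} {e : Fin (M + 1) → ι} (he : Function.Injective e) (p : Fin (M + 1)) :
    Finset.univ.image (fun k : Fin M => e (Equiv.swap 0 p k.succ)) =
      (Finset.univ.image e).erase (e p) := by
  ext x
  simp only [Finset.mem_image, Finset.mem_univ, true_and, Finset.mem_erase]
  constructor
  · rintro ⟨k, rfl⟩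
    refine ⟨fun h => ?_, _, rfl⟩
    have h1 := he h
    rw [Equiv.swap_apply_eq_iff, Equiv.swap_apply_right] at h1
    exact Fin.succ_ne_zero k h1
  · rintro ⟨h, q, rfl⟩
    have h0 : Equiv.swap 0 p q ≠ 0 := by
      intro h1
      rw [Equiv.swap_apply_eq_iff, Equiv.swap_apply_left] at h1
      exact h (h1 ▸ rfl)
    obtain ⟨k, hk⟩ := Fin.exists_succ_eq.2 h0
    exact ⟨k, by rw [hk, Equiv.swap_apply_self]⟩

/-- The explicit form of the Bethe vectors of a homogeneous chain. -/
lemma betheVec_eq_sum (hα : ∀ i, α i ≠ 0) (hδ : ∀ i, δ i ≠ 0) (v0 : H) (N : ℕ)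
    (B : Fin N → EndH H) {M : ℕ} (e : Fin M → ι) (he : Function.Injective e) :
    betheVec f α δ v0 N B (Finset.univ.image e) =
      ∑ n ∈ Finset.univ.filter (fun n : Fin M → Fin N => ∀ k l, k < l → n k < n l),
        betheCoeff f α δ N e (fun k => n k) • (List.ofFn fun k => B (n k)).prod v0 := by
  induction N generalizing M with
  | zero =>
    cases M with
    | zero => simp [betheVec, betheCoeff]
    | succ M => simp [betheVec, Finset.univ_nonempty.ne_empty]
  | succ N ih =>
    cases M with
    | zero => simp [betheVec_empty, betheCoeff]
    | succ M =>
      have hsum : ∀ p, Function.Injective fun k : Fin M => e (Equiv.swap 0 p k.succ) :=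
        fun p => he.comp ((Equiv.swap 0 p).injective.comp (Fin.succ_injective _))
      rw [betheVec, sum_strictMono_succ, ih _ e he, Finset.prod_image fun _ _ _ _ h => he h,
        Finset.sum_image fun _ _ _ _ h => he h]
      congr 1
      · rw [Finset.smul_sum]
        refine Finset.sum_congr rfl fun n _ => ?_
        rw [smul_smul, ← betheCoeff_shift hδ]
        simp only [Fin.val_succ]
      · have h1 : ∀ n : Fin M → Fin N,
            (fun k => ((Fin.cons 0 fun k => (n k).succ : Fin (M + 1) → Fin (N + 1)) k : ℕ)) =
              (Fin.cons 0 fun k => (n k : ℕ) + 1 : Fin (M + 1) → ℕ) := by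
          intro n
          funext k
          refine Fin.cases ?_ (fun k => ?_) k <;> simp
        simp only [h1, betheCoeff_cons hα hδ, Finset.sum_smul]
        rw [Finset.sum_comm]
        refine Finset.sum_congr rfl fun p _ => ?_
        rw [← image_swap_succ he p, ih _ _ (hsum p), Finset.prod_image fun _ _ _ _ h => hsum p h,
          map_sum, Finset.smul_sum]
        refine Finset.sum_congr rfl fun n _ => ?_
        rw [map_smul, smul_smul, List.ofFn_succ, List.prod_cons]
        simp

end Explicit

section Trigonometric

lemma gXXZ_antisymm (eta l m : ℂ) : gXXZ eta l m = -gXXZ eta m l := by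
  rw [gXXZ, gXXZ, ← neg_sub m l, Complex.sinh_neg, div_neg]

lemma fXXZ_gXXZ_exchange (eta : ℂ) {m i k : ℂ} (hmi : Complex.sinh (m - i) ≠ 0)
    (hmk : Complex.sinh (m - k) ≠ 0) (hik : Complex.sinh (i - k) ≠ 0) :
    fXXZ eta m i * gXXZ eta m k - gXXZ eta m i * gXXZ eta i k = gXXZ eta m k * fXXZ eta k i := by
  have hki : Complex.sinh (k - i) = -Complex.sinh (i - k) := by
    rw [← Complex.sinh_neg, neg_sub]
  have h2 : Complex.sinh (k - i + eta) = -Complex.sinh (i - k - eta) := by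
    rw [← Complex.sinh_neg]; congr 1; ring
  simp only [fXXZ, gXXZ, hki, h2]
  have h3 : m - k = (m - i) + (i - k) := by ring
  rw [h3] at hmk ⊢
  generalize m - i = x at *
  generalize i - k = y at *
  field_simp
  rw [Complex.sinh_sub, Complex.sinh_add, Complex.sinh_add]
  ring_nf

end Trigonometric

/-- A product of creation operators applied to the vacuum is the Bethe vector of the set of its
spectral parameters. -/
lemma list_prod_apply_eq {ι : Type} [DecidableEq ι] {B : ι → EndH H} {Ψ : Finset ι → H}
    (hΨ : ∀ i S, i ∉ S → B i (Ψ S) = Ψ (insert i S)) (l : List ι) (hl : l.Nodup) :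
    (l.map B).prod (Ψ ∅) = Ψ l.toFinset := by
  induction l with
  | nil => simp
  | cons i l ih =>
    rw [List.nodup_cons] at hl
    rw [List.map_cons, List.prod_cons, Module.End.mul_apply, ih hl.2,
      hΨ i _ (by simpa using hl.1), List.toFinset_cons]

/-- homogeneous chain (`ξ₁ = ⋯ = ξ_N = ξ`) with parameter-independent
creation operators `Bⱼ(λ) = Bⱼ`, XXZ case.  Note that `n : Fin M → Fin N` is
0-indexed, so the exponent `n_k` of the 1-indexed formula is `(n k : ℕ) + 1`. -/
theorem homogeneous_Bethe_vectors_XXZ {H : Type} [AddCommGroup H] [Module ℂ H]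
    (eta : ℂ) (N : ℕ) (hN : 1 ≤ N) (xi : ℂ) (Λ : Set ℂ)
    (L : Fin N → ℂ → Matrix (Fin 2) (Fin 2) (EndH H))
    (hRTT : ∀ j : Fin N, SatisfiesRTT Λ (fun lam mu => Complex.sinh (lam - mu) ≠ 0) (RXXZ eta) (L j))
    (hcomm : ∀ i j : Fin N, i ≠ j → ∀ lam mu : ℂ, lam ∈ Λ → mu ∈ Λ →
      ∀ a b c d : Fin 2, Commute (L i lam a b) (L j mu c d))
    (v0 : H) (hv0 : v0 ≠ 0) (alpha delta : ℂ → ℂ → ℂ)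
    (hA : ∀ (j : Fin N) (lam : ℂ), lam ∈ Λ → L j lam 0 0 v0 = alpha lam xi • v0)
    (hD : ∀ (j : Fin N) (lam : ℂ), lam ∈ Λ → L j lam 1 1 v0 = delta lam xi • v0)
    (hC : ∀ (j : Fin N) (lam : ℂ), lam ∈ Λ → L j lam 1 0 v0 = 0)
    (hBB : ∀ (j : Fin N) (lam mu : ℂ), lam ∈ Λ → mu ∈ Λ →
      (L j lam 0 1) ((L j mu 0 1) v0) = 0)
    (Bc : Fin N → EndH H)
    (hBconst : ∀ (j : Fin N) (lam : ℂ), lam ∈ Λ → L j lam 0 1 = Bc j)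
    (M : ℕ) (lam : Fin M → ℂ) (hlam : ∀ i, lam i ∈ Λ)
    (hdist : ∀ j k : Fin M, j ≠ k → Complex.sinh (lam j - lam k) ≠ 0)
    (halpha : ∀ l : Fin M, alpha (lam l) xi ≠ 0)
    (hdelta : ∀ l : Fin M, delta (lam l) xi ≠ 0) :
    ((List.ofFn (fun i : Fin M =>
        (List.ofFn (fun j : Fin N => L j (lam i))).prod 0 1)).prod) v0
      = (∏ l : Fin M, delta (lam l) xi ^ N / alpha (lam l) xi) •
          ∑ n ∈ Finset.univ.filter
              (fun n : Fin M → Fin N => ∀ k l : Fin M, k < l → n k < n l),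
            ((∑ σ : Equiv.Perm (Fin M),
                (∏ i : Fin M, ∏ j ∈ Finset.univ.filter (fun j : Fin M => i < j),
                    (fXXZ eta) (lam (σ i)) (lam (σ j))) *
                  ∏ k : Fin M,
                    (alpha (lam (σ k)) xi / delta (lam (σ k)) xi) ^ ((n k : ℕ) + 1)) •
              (((List.ofFn (fun k : Fin M => Bc (n k))).prod) v0)) := by
  have hΨ := creation_apply_betheVec (v0 := v0) (B := Bc) (L := fun n i => L n (lam i))
    (f := fun i j => fXXZ eta (lam i) (lam j)) (g := fun i j => gXXZ eta (lam i) (lam j))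
    (α := fun i => alpha (lam i) xi) (δ := fun i => delta (lam i) xi)
    (fun i j => gXXZ_antisymm _ _ _)
    (fun m i k hmi hmk hik =>
      fXXZ_gXXZ_exchange eta (hdist _ _ hmi) (hdist _ _ hmk) (hdist _ _ hik))
    (fun n i j hij => hRTT n _ _ (hlam i) (hlam j) (hdist i j hij))
    (fun m n hmn i j => hcomm m n hmn _ _ (hlam i) (hlam j))
    (fun n i => hA n _ (hlam i)) (fun n i => hD n _ (hlam i)) (fun n i => hC n _ (hlam i))
    (fun n i => hBconst n _ (hlam i))
  cases M with
  | zero => simp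
  | succ M =>
    have hBB' : ∀ n, Bc n (Bc n v0) = 0 := fun n => by
      have h := hBB n _ _ (hlam 0) (hlam 0)
      rwa [hBconst n _ (hlam 0)] at h
    have h1 := list_prod_apply_eq (hΨ hBB') (List.finRange (M + 1)) (List.nodup_finRange _)
    rw [betheVec_empty, ← List.ofFn_eq_map, List.toFinset_finRange, ← Finset.image_id (s := .univ),
      betheVec_eq_sum halpha hdelta v0 N Bc id Function.injective_id] at h1
    rw [h1, Finset.smul_sum]
    exact Finset.sum_congr rfl fun n _ => by rw [smul_smul]; rfl

end
end

section
/- (Induction step for the multi-component model.) Let H be a complex vector space and for j = K−1, K let Tⱼ(λ) = [[Aⱼ(λ),Bⱼ(λ)],[Cⱼ(λ),Dⱼ(λ)]] be monodromy matrices on H with common domain Λ ⊆ ℂ, each satisfying the RTT relation with the rational (XXX-type) R-matrix, with mutually commuting entries between the two families, and a common nonzero vector |0⟩ with Aⱼ(λ)|0⟩ = aⱼ(λ)|0⟩, Dⱼ(λ)|0⟩ = dⱼ(λ)|0⟩, Cⱼ(λ)|0⟩ = 0. Let B(λ) = A_{K−1}(λ)B_K(λ) + B_{K−1}(λ)D_K(λ)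 be the (1,2) entry of T_{K−1}(λ)T_K(λ). Then for any finite index set 𝒥 and pairwise distinct parameters (λ_k)_{k∈𝒥} ⊆ Λ: ∏_{k∈𝒥} B(λ_k) |0⟩ = Σ ( ∏_{i∈𝒥', j∈𝒥''} f(λ_i,λ_j) ) ( ∏_{i∈𝒥'} d_K(λ_i) ) ( ∏_{j∈𝒥''} a_{K−1}(λ_j) ) ( ∏_{i∈𝒥'} B_{K−1}(λ_i) ) ( ∏_{j∈𝒥''} B_K(λ_j) ) |0⟩, where f(λ,μ) = (λ−μ+1)/(λ−μ) and the sum runs over all divisions of 𝒥 into two disjoint subsets 𝒥', 𝒥'' with 𝒥' ∪ 𝒥'' = 𝒥; products of B-operators of the same component may be taken in any order since they commute. -/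
open scoped BigOperators

noncomputable section

variable {H : Type} [AddCommGroup H] [Module ℂ H]

lemma fXXX_eq_one_add {l m : ℂ} (hlm : l ≠ m) : fXXX l m = 1 + gXXX l m := by
  have := sub_ne_zero.mpr hlm
  unfold fXXX gXXX
  field_simp

lemma gXXX_swap (x y : ℂ) : gXXX y x = -gXXX x y := by
  unfold gXXX
  rw [← neg_sub x y, div_neg]

lemma embedR_RXXX_apply {l m : ℂ} (hlm : l ≠ m) (p q : Fin 2 × Fin 2) :
    embedR (H := H) (RXXX l m) p q
      = (if p = q then 1 else 0) + (if p.swap = q then gXXX l m • 1 else 0) := by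
  obtain ⟨a, b⟩ := p
  obtain ⟨c, d⟩ := q
  fin_cases a <;> fin_cases b <;> fin_cases c <;> fin_cases d <;>
    simp [embedR, RXXX, Rfg, fXXX_eq_one_add hlm, add_smul]

lemma embedR_RXXX_mul_apply {l m : ℂ} (hlm : l ≠ m)
    (X : Matrix (Fin 2 × Fin 2) (Fin 2 × Fin 2) (EndH H)) (p q : Fin 2 × Fin 2) :
    (embedR (H := H) (RXXX l m) * X : Matrix (Fin 2 × Fin 2) (Fin 2 × Fin 2) (EndH H)) p q
      = X p q + gXXX l m • X p.swap q := by
  simp [Matrix.mul_apply, embedR_RXXX_apply hlm, add_mul, Finset.sum_add_distrib, ite_mul]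

lemma mul_embedR_RXXX_apply {l m : ℂ} (hlm : l ≠ m)
    (X : Matrix (Fin 2 × Fin 2) (Fin 2 × Fin 2) (EndH H)) (p q : Fin 2 × Fin 2) :
    (X * embedR (H := H) (RXXX l m) : Matrix (Fin 2 × Fin 2) (Fin 2 × Fin 2) (EndH H)) p q
      = X p q + gXXX l m • X p q.swap := by
  have hswap : ∀ r : Fin 2 × Fin 2, r.swap = q ↔ r = q.swap := fun r => Prod.swap_eq_iff_eq_swap
  simp [Matrix.mul_apply, embedR_RXXX_apply hlm, mul_add, Finset.sum_add_distrib, mul_ite, hswap]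

lemma aux1_mul_aux2_apply (S T : Matrix (Fin 2) (Fin 2) (EndH H)) (p q : Fin 2 × Fin 2) :
    (aux1 S * aux2 T) p q = S p.1 q.1 * T p.2 q.2 := by
  simp [Matrix.mul_apply, Fintype.sum_prod_type, aux1, aux2, ite_mul, mul_ite]

lemma aux2_mul_aux1_apply (S T : Matrix (Fin 2) (Fin 2) (EndH H)) (p q : Fin 2 × Fin 2) :
    (aux2 T * aux1 S) p q = T p.2 q.2 * S p.1 q.1 := by
  simp [Matrix.mul_apply, Fintype.sum_prod_type, aux1, aux2, ite_mul, mul_ite]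

/-- Entrywise form of the RTT relation for the rational R-matrix. -/
lemma SatisfiesRTT.entry {Λ : Set ℂ} {T : ℂ → Matrix (Fin 2) (Fin 2) (EndH H)}
    (h : SatisfiesRTT Λ (fun lam mu => lam ≠ mu) RXXX T) {l m : ℂ} (hl : l ∈ Λ) (hm : m ∈ Λ)
    (hlm : l ≠ m) (a b c d : Fin 2) :
    T l a b * T m c d + gXXX l m • (T l c b * T m a d)
      = T m c d * T l a b + gXXX l m • (T m c b * T l a d) := by
  have key := congrFun (congrFun (h l m hl hm hlm) (a, c)) (b, d)
  rw [mul_assoc, embedR_RXXX_mul_apply hlm, mul_embedR_RXXX_apply hlm] at key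
  simpa only [aux1_mul_aux2_apply, aux2_mul_aux1_apply, Prod.swap_prod_mk] using key

lemma SatisfiesRTT.commute_B {Λ : Set ℂ} {T : ℂ → Matrix (Fin 2) (Fin 2) (EndH H)}
    (h : SatisfiesRTT Λ (fun lam mu => lam ≠ mu) RXXX T) {l m : ℂ} (hl : l ∈ Λ) (hm : m ∈ Λ) :
    Commute (T l 0 1) (T m 0 1) := by
  rcases eq_or_ne l m with rfl | hlm
  · exact Commute.refl _
  have e₁ := h.entry hl hm hlm 0 1 0 1
  have e₂ := h.entry hm hl hlm.symm 0 1 0 1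
  rw [gXXX_swap l m] at e₂
  have e₃ : (2 : ℂ) • (T l 0 1 * T m 0 1 - T m 0 1 * T l 0 1) = 0 := by
    rw [neg_smul, neg_smul] at e₂
    rw [two_smul]
    linear_combination (norm := abel) e₁ - e₂
  exact sub_eq_zero.mp ((smul_eq_zero.mp e₃).resolve_left two_ne_zero)

lemma SatisfiesRTT.A_mul_B {Λ : Set ℂ} {T : ℂ → Matrix (Fin 2) (Fin 2) (EndH H)}
    (h : SatisfiesRTT Λ (fun lam mu => lam ≠ mu) RXXX T) {l m : ℂ} (hl : l ∈ Λ) (hm : m ∈ Λ)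
    (hlm : l ≠ m) :
    T l 0 0 * T m 0 1
      = fXXX m l • (T m 0 1 * T l 0 0) - gXXX m l • (T l 0 1 * T m 0 0) := by
  rw [fXXX_eq_one_add hlm.symm, add_smul, one_smul, h.entry hm hl hlm.symm 0 1 0 0,
    add_sub_cancel_right]

lemma SatisfiesRTT.D_mul_B {Λ : Set ℂ} {T : ℂ → Matrix (Fin 2) (Fin 2) (EndH H)}
    (h : SatisfiesRTT Λ (fun lam mu => lam ≠ mu) RXXX T) {l m : ℂ} (hl : l ∈ Λ) (hm : m ∈ Λ)
    (hlm : l ≠ m) :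
    T l 1 1 * T m 0 1
      = fXXX l m • (T m 0 1 * T l 1 1) - gXXX l m • (T l 0 1 * T m 1 1) := by
  rw [fXXX_eq_one_add hlm, add_smul, one_smul, ← h.entry hl hm hlm 1 1 0 1,
    add_sub_cancel_right]

section OrderedProduct

variable {ι : Type} [LinearOrder ι]

@[simp]
lemma finsetOpProd_empty (B : ι → EndH H) : finsetOpProd ∅ B = 1 := by
  simp [finsetOpProd]

lemma finsetOpProd_insert_of_lt {k : ι} {S : Finset ι} (hk : ∀ i ∈ S, k < i) (B : ι → EndH H) :
    finsetOpProd (insert k S) B = B k * finsetOpProd S B := by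
  rw [finsetOpProd, finsetOpProd,
    Finset.sort_insert _ (fun i hi => (hk i hi).le) (fun h => lt_irrefl k (hk k h)),
    List.map_cons, List.prod_cons]

lemma finsetOpProd_insert {k : ι} {S : Finset ι} (hk : k ∉ S) (B : ι → EndH H)
    (hB : ∀ i ∈ insert k S, ∀ j ∈ insert k S, Commute (B i) (B j)) :
    finsetOpProd (insert k S) B = B k * finsetOpProd S B := by
  rw [finsetOpProd, finsetOpProd, ← List.prod_cons, ← List.map_cons]
  refine List.Perm.prod_eq' (List.Perm.map B ?_) ?_
  · rw [← Multiset.coe_eq_coe, ← Multiset.cons_coe]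
    simp [Finset.insert_val_of_notMem hk]
  · rw [List.pairwise_map]
    exact List.pairwise_of_forall_mem_list fun i hi j hj =>
      hB i ((Finset.mem_sort _).mp hi) j ((Finset.mem_sort _).mp hj)

lemma commute_finsetOpProd {X : EndH H} {S : Finset ι} {B : ι → EndH H}
    (h : ∀ i ∈ S, Commute X (B i)) : Commute X (finsetOpProd S B) := by
  refine Commute.list_prod_right _ _ fun y hy => ?_
  obtain ⟨i, hi, rfl⟩ := List.mem_map.mp hy
  exact h i ((Finset.mem_sort _).mp hi)

/-- Action of an operator `A k` on the Bethe-type vector `∏_{i ∈ S} B i v`, for exchange relations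
with coefficients `f` and `g`. -/
lemma action_on_finsetOpProd {J : Finset ι} {A B : ι → EndH H} {a : ι → ℂ} {f g : ι → ι → ℂ}
    {v : H}
    (hB : ∀ i ∈ J, ∀ j ∈ J, Commute (B i) (B j))
    (hAB : ∀ i ∈ J, ∀ j ∈ J, i ≠ j →
      A i * B j = f j i • (B j * A i) - g j i • (B i * A j))
    (hfg : ∀ i ∈ J, ∀ l ∈ J, ∀ m ∈ J, i ≠ l → l ≠ m → i ≠ m →
      f l m * g i m - g l m * g i l = g i m * f l i)
    (hv : ∀ i ∈ J, A i v = a i • v)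
    (S : Finset ι) (hS : S ⊆ J) {k : ι} (hkJ : k ∈ J) (hk : k ∉ S) :
    A k (finsetOpProd S B v)
      = (a k * ∏ i ∈ S, f i k) • finsetOpProd S B v
        - ∑ i ∈ S, (g i k * a i * ∏ j ∈ S.erase i, f j i) •
            finsetOpProd (insert k (S.erase i)) B v := by
  induction S using Finset.induction_on generalizing k with
  | empty => simp [hv k hkJ]
  | insert l S hl ih =>
    have hlJ : l ∈ J := hS (Finset.mem_insert_self l S)
    have hSJ : S ⊆ J := (Finset.subset_insert l S).trans hS
    have hkl : k ≠ l := fun h => hk (h ▸ Finset.mem_insert_self l S)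
    have hkS : k ∉ S := fun h => hk (Finset.mem_insert_of_mem h)
    have ins : ∀ {m : ι} {U : Finset ι}, m ∈ J → U ⊆ J → m ∉ U →
        finsetOpProd (insert m U) B v = B m (finsetOpProd U B v) := fun hm hU hmU => by
      have hs := Finset.insert_subset hm hU
      rw [finsetOpProd_insert hmU B fun i hi j hj => hB i (hs hi) j (hs hj)]
      rfl
    have hex : ∀ w, A k (B l w) = f l k • B l (A k w) - g l k • B k (A l w) := fun w => by
      simpa using LinearMap.congr_fun (hAB k hkJ l hlJ hkl) w
    have hBB : ∀ w, B l (B k w) = B k (B l w) := fun w =>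
      LinearMap.congr_fun (hB l hlJ k hkJ).eq w
    have hterm : ∀ i ∈ S,
        (g i k * a i * ∏ j ∈ (insert l S).erase i, f j i) •
            finsetOpProd (insert k ((insert l S).erase i)) B v
          = (f l k * (g i k * a i * ∏ j ∈ S.erase i, f j i)) •
              B l (finsetOpProd (insert k (S.erase i)) B v)
            - (g l k * (g i l * a i * ∏ j ∈ S.erase i, f j i)) •
              B k (finsetOpProd (insert l (S.erase i)) B v) := fun i hi => by
      have hil : i ≠ l := fun h => hl (h ▸ hi)
      have hik : i ≠ k := fun h => hkS (h ▸ hi)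
      have hU : S.erase i ⊆ J := (Finset.erase_subset i S).trans hSJ
      have hlU : l ∉ S.erase i := fun h => hl (Finset.mem_of_mem_erase h)
      have hkU : k ∉ S.erase i := fun h => hkS (Finset.mem_of_mem_erase h)
      rw [Finset.erase_insert_of_ne hil.symm, Finset.prod_insert hlU,
        ins hkJ (Finset.insert_subset hlJ hU) (by simp [hkl, hkS]), ins hkJ hU hkU,
        ins hlJ hU hlU, hBB, ← sub_smul]
      congr 1
      linear_combination (-(a i * ∏ j ∈ S.erase i, f j i)) *
        hfg i (hSJ hi) l hlJ k hkJ hil hkl.symm hik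
    rw [Finset.sum_insert hl, Finset.sum_congr rfl hterm, Finset.sum_sub_distrib,
      Finset.erase_insert hl, ins hlJ hSJ hl, ins hkJ hSJ hkS, Finset.prod_insert hl, hex,
      ih hSJ hkJ hkS, ih hSJ hlJ hl]
    simp only [map_sub, map_sum, map_smul, smul_sub, Finset.smul_sum, smul_smul]
    rw [show f l k * (a k * ∏ i ∈ S, f i k) = a k * (f l k * ∏ i ∈ S, f i k) by ring,
      show g l k * (a l * ∏ i ∈ S, f i l) = g l k * a l * ∏ i ∈ S, f i l by ring]
    abel

end OrderedProduct

lemma sum_powerset_sum_mem {ι M : Type*} [DecidableEq ι] [AddCommMonoid M] (S : Finset ι)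
    (X : Finset ι → ι → M) :
    ∑ t ∈ S.powerset, ∑ i ∈ t, X t i = ∑ t ∈ S.powerset, ∑ i ∈ S \ t, X (insert i t) i := by
  rw [Finset.sum_sigma', Finset.sum_sigma']
  refine Finset.sum_bij' (fun p _ => ⟨p.1.erase p.2, p.2⟩) (fun p _ => ⟨insert p.2 p.1, p.2⟩)
    ?_ ?_ ?_ ?_ ?_
  · rintro ⟨t, i⟩ h
    simp only [Finset.mem_sigma, Finset.mem_powerset, Finset.mem_sdiff] at h ⊢
    exact ⟨(Finset.erase_subset i t).trans h.1, h.1 h.2, Finset.notMem_erase i t⟩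
  · rintro ⟨t, i⟩ h
    simp only [Finset.mem_sigma, Finset.mem_powerset, Finset.mem_sdiff] at h ⊢
    exact ⟨Finset.insert_subset h.2.1 h.1, Finset.mem_insert_self i t⟩
  · rintro ⟨t, i⟩ h
    simp only [Finset.mem_sigma] at h
    simp [Finset.insert_erase h.2]
  · rintro ⟨t, i⟩ h
    simp only [Finset.mem_sigma, Finset.mem_sdiff] at h
    simp [Finset.erase_insert h.2.2]
  · rintro ⟨t, i⟩ h
    simp only [Finset.mem_sigma] at h
    simp [Finset.insert_erase h.2]

lemma fXXX_mul_gXXX_sub {x y z : ℂ} (hxy : x ≠ y) (hyz : y ≠ z) (hxz : x ≠ z) :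
    fXXX y z * gXXX x z - gXXX y z * gXXX x y = gXXX x z * fXXX y x := by
  have h₁ := sub_ne_zero.mpr hxy
  have h₂ := sub_ne_zero.mpr hyz
  have h₃ := sub_ne_zero.mpr hxz
  have h₄ := sub_ne_zero.mpr hxy.symm
  unfold fXXX gXXX
  field_simp
  ring

lemma fXXX_mul_gXXX_sub' {x y z : ℂ} (hxy : x ≠ y) (hyz : y ≠ z) (hxz : x ≠ z) :
    fXXX z y * gXXX z x - gXXX z y * gXXX y x = gXXX z x * fXXX x y := by
  have h₁ := sub_ne_zero.mpr hxy
  have h₂ := sub_ne_zero.mpr hyz.symm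
  have h₃ := sub_ne_zero.mpr hxz.symm
  have h₄ := sub_ne_zero.mpr hxy.symm
  unfold fXXX gXXX
  field_simp
  ring

/-- induction step for the multi-component model (XXX case): the
two-component formula for the components `K-1` and `K`, for an arbitrary finite index
set `𝒥` of spectral parameters. -/
theorem induction_step_two_component {H : Type} [AddCommGroup H] [Module ℂ H]
    {ι : Type} [Fintype ι] [LinearOrder ι]
    (Λ : Set ℂ)
    (TKm1 TK : ℂ → Matrix (Fin 2) (Fin 2) (EndH H))
    (h1 : SatisfiesRTT Λ (fun lam mu => lam ≠ mu) RXXX TKm1)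
    (h2 : SatisfiesRTT Λ (fun lam mu => lam ≠ mu) RXXX TK)
    (hcomm : ∀ lam mu : ℂ, lam ∈ Λ → mu ∈ Λ →
      ∀ a b c d : Fin 2, Commute (TKm1 lam a b) (TK mu c d))
    (v0 : H) (hv0 : v0 ≠ 0) (aKm1 dKm1 aK dK : ℂ → ℂ)
    (hA1 : ∀ lam : ℂ, lam ∈ Λ → TKm1 lam 0 0 v0 = aKm1 lam • v0)
    (hD1 : ∀ lam : ℂ, lam ∈ Λ → TKm1 lam 1 1 v0 = dKm1 lam • v0)
    (hC1 : ∀ lam : ℂ, lam ∈ Λ → TKm1 lam 1 0 v0 = 0)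
    (hA2 : ∀ lam : ℂ, lam ∈ Λ → TK lam 0 0 v0 = aK lam • v0)
    (hD2 : ∀ lam : ℂ, lam ∈ Λ → TK lam 1 1 v0 = dK lam • v0)
    (hC2 : ∀ lam : ℂ, lam ∈ Λ → TK lam 1 0 v0 = 0)
    (J : Finset ι) (lam : ι → ℂ) (hlam : ∀ k ∈ J, lam k ∈ Λ)
    (hdist : ∀ k ∈ J, ∀ l ∈ J, k ≠ l → lam k ≠ lam l) :
    (finsetOpProd J (fun k =>
        TKm1 (lam k) 0 0 * TK (lam k) 0 1 + TKm1 (lam k) 0 1 * TK (lam k) 1 1)) v0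
      = ∑ J' ∈ J.powerset,
          (((∏ i ∈ J', ∏ j ∈ J \ J', fXXX (lam i) (lam j)) *
              (∏ i ∈ J', dK (lam i)) * (∏ j ∈ J \ J', aKm1 (lam j))) •
            ((finsetOpProd J' (fun i => TKm1 (lam i) 0 1) *
                finsetOpProd (J \ J') (fun j => TK (lam j) 0 1)) v0)) := by
  set A₁ : ι → EndH H := fun k => TKm1 (lam k) 0 0 with hA₁
  set B₁ : ι → EndH H := fun k => TKm1 (lam k) 0 1 with hB₁
  set B₂ : ι → EndH H := fun k => TK (lam k) 0 1 with hB₂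
  set D₂ : ι → EndH H := fun k => TK (lam k) 1 1 with hD₂
  suffices main : ∀ S : Finset ι, S ⊆ J →
      finsetOpProd S (fun k => A₁ k * B₂ k + B₁ k * D₂ k) v0
        = ∑ t ∈ S.powerset,
            ((∏ i ∈ t, ∏ j ∈ S \ t, fXXX (lam i) (lam j)) *
              (∏ i ∈ t, dK (lam i)) * (∏ j ∈ S \ t, aKm1 (lam j))) •
            (finsetOpProd t B₁ (finsetOpProd (S \ t) B₂ v0)) from main J subset_rfl
  have c₁ : ∀ i ∈ J, ∀ j ∈ J, Commute (B₁ i) (B₁ j) := fun i hi j hj =>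
    h1.commute_B (hlam i hi) (hlam j hj)
  have c₂ : ∀ i ∈ J, ∀ j ∈ J, Commute (B₂ i) (B₂ j) := fun i hi j hj =>
    h2.commute_B (hlam i hi) (hlam j hj)
  have ins₁ : ∀ {m : ι} {U : Finset ι} (w : H), m ∈ J → U ⊆ J → m ∉ U →
      finsetOpProd (insert m U) B₁ w = B₁ m (finsetOpProd U B₁ w) := fun w hm hU hmU => by
    have hs := Finset.insert_subset hm hU
    rw [finsetOpProd_insert hmU B₁ fun i hi j hj => c₁ i (hs hi) j (hs hj)]
    rfl
  have ins₂ : ∀ {m : ι} {U : Finset ι} (w : H), m ∈ J → U ⊆ J → m ∉ U →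
      finsetOpProd (insert m U) B₂ w = B₂ m (finsetOpProd U B₂ w) := fun w hm hU hmU => by
    have hs := Finset.insert_subset hm hU
    rw [finsetOpProd_insert hmU B₂ fun i hi j hj => c₂ i (hs hi) j (hs hj)]
    rfl
  have actA : ∀ (t u : Finset ι) (k : ι), t ⊆ J → u ⊆ J → k ∈ J → k ∉ t →
      A₁ k (finsetOpProd t B₁ (finsetOpProd u B₂ v0))
        = (aKm1 (lam k) * ∏ i ∈ t, fXXX (lam i) (lam k)) •
            finsetOpProd t B₁ (finsetOpProd u B₂ v0)
          - ∑ i ∈ t, (gXXX (lam i) (lam k) * aKm1 (lam i) *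
              ∏ j ∈ t.erase i, fXXX (lam j) (lam i)) •
              finsetOpProd (insert k (t.erase i)) B₁ (finsetOpProd u B₂ v0) := by
    intro t u k ht hu hk hkt
    refine action_on_finsetOpProd (J := J) (a := fun i => aKm1 (lam i))
      (f := fun i j => fXXX (lam i) (lam j)) (g := fun i j => gXXX (lam i) (lam j)) c₁
      (fun i hi j hj hij => h1.A_mul_B (hlam i hi) (hlam j hj) (hdist i hi j hj hij))
      (fun i hi l hl m hm hil hlm him => fXXX_mul_gXXX_sub (hdist i hi l hl hil)
        (hdist l hl m hm hlm) (hdist i hi m hm him))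
      (fun i hi => ?_) t ht hk hkt
    have hc : Commute (A₁ i) (finsetOpProd u B₂) := commute_finsetOpProd fun j hj =>
      hcomm _ _ (hlam i hi) (hlam j (hu hj)) 0 0 0 1
    have hv : A₁ i v0 = aKm1 (lam i) • v0 := hA1 _ (hlam i hi)
    rw [← Module.End.mul_apply, hc.eq, Module.End.mul_apply, hv, map_smul]
  have actD : ∀ (u : Finset ι) (k : ι), u ⊆ J → k ∈ J → k ∉ u →
      D₂ k (finsetOpProd u B₂ v0)
        = (dK (lam k) * ∏ i ∈ u, fXXX (lam k) (lam i)) • finsetOpProd u B₂ v0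
          - ∑ i ∈ u, (gXXX (lam k) (lam i) * dK (lam i) *
              ∏ j ∈ u.erase i, fXXX (lam i) (lam j)) •
              finsetOpProd (insert k (u.erase i)) B₂ v0 := by
    intro u k hu hk hku
    exact action_on_finsetOpProd (J := J) (a := fun i => dK (lam i))
      (f := fun i j => fXXX (lam j) (lam i)) (g := fun i j => gXXX (lam j) (lam i)) c₂
      (fun i hi j hj hij => h2.D_mul_B (hlam i hi) (hlam j hj) (hdist i hi j hj hij))
      (fun i hi l hl m hm hil hlm him => fXXX_mul_gXXX_sub' (hdist i hi l hl hil)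
        (hdist l hl m hm hlm) (hdist i hi m hm him))
      (fun i hi => hD2 _ (hlam i hi)) u hu hk hku
  intro S
  induction S using Finset.induction_on_min with
  | empty => simp
  | insert k S hlt ih =>
    intro hS
    have hkJ : k ∈ J := hS (Finset.mem_insert_self k S)
    have hSJ : S ⊆ J := (Finset.subset_insert k S).trans hS
    have hkS : k ∉ S := fun h => lt_irrefl k (hlt k h)
    set c : Finset ι → Finset ι → ℂ := fun t u =>
      (∏ i ∈ t, ∏ j ∈ u, fXXX (lam i) (lam j)) * (∏ i ∈ t, dK (lam i)) *
        (∏ j ∈ u, aKm1 (lam j)) with hc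
    set W : Finset ι → Finset ι → H := fun t u =>
      finsetOpProd t B₁ (finsetOpProd u B₂ v0) with hW
    set X : Finset ι → ι → H := fun t i =>
      (c t (S \ t) * (gXXX (lam i) (lam k) * aKm1 (lam i) *
        ∏ j ∈ t.erase i, fXXX (lam j) (lam i))) •
          W (insert k (t.erase i)) (insert k (S \ t)) with hX
    set Y : Finset ι → ι → H := fun t i =>
      (c t (S \ t) * (gXXX (lam k) (lam i) * dK (lam i) *
        ∏ j ∈ (S \ t).erase i, fXXX (lam i) (lam j))) •
          W (insert k t) (insert k ((S \ t).erase i)) with hY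
    have hstep : ∀ t ∈ S.powerset,
        (A₁ k * B₂ k + B₁ k * D₂ k) (c t (S \ t) • W t (S \ t))
          = c t (insert k (S \ t)) • W t (insert k (S \ t))
            + c (insert k t) (S \ t) • W (insert k t) (S \ t)
            - (∑ i ∈ t, X t i + ∑ i ∈ S \ t, Y t i) := by
      intro t ht
      have htS := Finset.mem_powerset.mp ht
      have htJ := htS.trans hSJ
      have huJ : S \ t ⊆ J := Finset.sdiff_subset.trans hSJ
      have hkt : k ∉ t := fun h => hkS (htS h)
      have hku : k ∉ S \ t := fun h => hkS (Finset.sdiff_subset h)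
      have hcB : Commute (B₂ k) (finsetOpProd t B₁) := commute_finsetOpProd fun j hj =>
        (hcomm _ _ (hlam j (htJ hj)) (hlam k hkJ) 0 1 0 1).symm
      have hcD : Commute (D₂ k) (finsetOpProd t B₁) := commute_finsetOpProd fun j hj =>
        (hcomm _ _ (hlam j (htJ hj)) (hlam k hkJ) 0 1 1 1).symm
      have eB : B₂ k (W t (S \ t)) = W t (insert k (S \ t)) := by
        simp only [hW]
        rw [ins₂ v0 hkJ huJ hku, ← Module.End.mul_apply, hcB.eq, Module.End.mul_apply]
      have eD : B₁ k (D₂ k (W t (S \ t)))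
          = finsetOpProd (insert k t) B₁ (D₂ k (finsetOpProd (S \ t) B₂ v0)) := by
        simp only [hW]
        rw [ins₁ _ hkJ htJ hkt, ← Module.End.mul_apply (D₂ k), hcD.eq, Module.End.mul_apply]
      have c₁' : c t (insert k (S \ t))
          = c t (S \ t) * (aKm1 (lam k) * ∏ i ∈ t, fXXX (lam i) (lam k)) := by
        simp only [hc, Finset.prod_insert hku, Finset.prod_mul_distrib]
        ring
      have c₂' : c (insert k t) (S \ t)
          = c t (S \ t) * (dK (lam k) * ∏ i ∈ S \ t, fXXX (lam k) (lam i)) := by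
        simp only [hc, Finset.prod_insert hkt]
        ring
      rw [LinearMap.add_apply, Module.End.mul_apply, Module.End.mul_apply, map_smul, map_smul,
        map_smul, map_smul, eB, eD, actD _ _ huJ hkJ hku,
        actA _ _ _ htJ (Finset.insert_subset hkJ huJ) hkJ hkt, c₁', c₂']
      simp only [hX, hY, hW, map_sub, map_sum, map_smul, smul_sub, Finset.smul_sum, smul_smul]
      abel
    have hcancel : ∑ t ∈ S.powerset, (∑ i ∈ t, X t i + ∑ i ∈ S \ t, Y t i) = 0 := by
      rw [Finset.sum_add_distrib, sum_powerset_sum_mem, ← Finset.sum_add_distrib]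
      refine Finset.sum_eq_zero fun t _ => ?_
      rw [← Finset.sum_add_distrib]
      refine Finset.sum_eq_zero fun i hi => ?_
      have hit : i ∉ t := (Finset.mem_sdiff.mp hi).2
      have hu : S \ insert i t = (S \ t).erase i := by
        ext j
        simp only [Finset.mem_sdiff, Finset.mem_insert, Finset.mem_erase]
        tauto
      simp only [hX, hY]
      rw [hu, Finset.erase_insert hit, ← add_smul]
      convert zero_smul ℂ _
      obtain ⟨u, hiu, hu'⟩ : ∃ u, i ∉ u ∧ S \ t = insert i u :=
        ⟨(S \ t).erase i, Finset.notMem_erase _ _, (Finset.insert_erase hi).symm⟩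
      simp only [hc, hu', Finset.erase_insert hiu, Finset.prod_insert hit,
        Finset.prod_insert hiu, Finset.prod_mul_distrib]
      rw [gXXX_swap (lam i) (lam k)]
      ring
    have hright : ∀ t ∈ S.powerset, insert k S \ t = insert k (S \ t) := fun t ht =>
      Finset.insert_sdiff_of_notMem S fun h => hkS (Finset.mem_powerset.mp ht h)
    have hright' : ∀ t ∈ S.powerset, insert k S \ insert k t = S \ t := fun t _ => by
      rw [Finset.insert_sdiff_insert, Finset.sdiff_insert_of_notMem hkS]
    rw [finsetOpProd_insert_of_lt hlt, Module.End.mul_apply, ih hSJ]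
    change (A₁ k * B₂ k + B₁ k * D₂ k) (∑ t ∈ S.powerset, c t (S \ t) • W t (S \ t))
      = ∑ t ∈ (insert k S).powerset, c t (insert k S \ t) • W t (insert k S \ t)
    rw [map_sum, Finset.sum_congr rfl hstep, Finset.sum_sub_distrib, hcancel, sub_zero,
      Finset.sum_add_distrib, Finset.sum_powerset_insert hkS]
    refine congrArg₂ (· + ·) (Finset.sum_congr rfl fun t ht => ?_)
      (Finset.sum_congr rfl fun t ht => ?_)
    · rw [hright t ht]
    · rw [hright' t ht]

end
end
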